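/- arXiv:2203.16664 — 2 statements merged into one kernel-verified Lean document; each statement's English description precedes it below -/
import Mathlib

section
/- Let Q and H be real Hilbert spaces and ι : Q → H an injective bounded linear map. Let b̃ : Q × Q → ℝ be a symmetric bounded bilinear form with b̃(q,q) ≥ c_b‖q‖_Q² (c_b > 0), and let c̃ : H × H → ℝ be a symmetric bilinear form with 0 ≤ c̃(h,h) ≤ ω‖h‖_H² for all h ∈ H, where ω ≤ 1/5. Let 0 < τ ≤ 1, T = Nτ with N ∈ ℕ, and t^n := nτ. Let r : [0,T] → H be any function, and let z : [−2τ, T] → Q be such that ι∘z is three times continuously differentiable with M₃ := sup_{s ∈ [−2τ,T]} ‖(ι∘z)'''(s)‖_H < ∞, and such that for all t ∈ [0,T] and all q ∈ Q: ⟨(ι∘z)'(t), ιq⟩_H + b̃(z(t), q) + c̃(2(ι∘z)'(t−τ) − (ι∘z)'(t−2τ), ιq) = ⟨r(t), ιq⟩_H. Let z^n ∈ Q for n ≥ −2 satisfy z^0 = z(0), z^{−1} = z(−τ), z^{−2} = z(−2τ), with z^1 ∈ Q arbitrary, and for all n ≥ 0 and all q ∈ Q: ⟨ι(3z^{n+2}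 − 4z^{n+1} + z^n), ιq⟩_H + 2τ·b̃(z^{n+2}, q) + 2·c̃(ι(3z^{n+1} − 4z^n + z^{n−1}), ιq) − c̃(ι(3z^n − 4z^{n−1} + z^{n−2}), ιq) = 2τ·⟨r(t^{n+2}), ιq⟩_H. Then there exists a constant C > 0, depending only on c_b, ‖ι‖, ω, and M₃, such that for all 2 ≤ n ≤ N: ‖ι(z(t^n) − z^n)‖_H² + τ·Σ_{j=2}^{n} ‖z(t^j) − z^j‖_Q² ≤ C·( t^n·τ⁴ + E_init ), where E_init := ‖ι(z(τ) − z^1)‖_H² + τ·‖z(τ) − z^1‖_Q². -/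
open scoped RealInnerProductSpace

universe u v

section Consistency

variable {E : Type*} [NormedAddCommGroup E] [NormedSpace ℝ E]

/-- Consistency of the BDF-2 difference quotient: if the third derivative `f₃` of `f` is bounded
by `M` on a convex set containing `t - 2τ` and `t`, then the defect is `O(τ³)`. -/
lemma norm_bdf2_sub_deriv_le {f f₁ f₂ f₃ : ℝ → E} {s : Set ℝ} (hs : Convex ℝ s) {M : ℝ}
    (h₁ : ∀ x ∈ s, HasDerivWithinAt f (f₁ x) s x)
    (h₂ : ∀ x ∈ s, HasDerivWithinAt f₁ (f₂ x) s x)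
    (h₃ : ∀ x ∈ s, HasDerivWithinAt f₂ (f₃ x) s x)
    (hM : ∀ x ∈ s, ‖f₃ x‖ ≤ M) {t τ : ℝ} (hτ : 0 ≤ τ) (ht : t ∈ s) (ht' : t - 2 * τ ∈ s) :
    ‖(3 : ℝ) • f t - (4 : ℝ) • f (t - τ) + f (t - 2 * τ) - (2 * τ) • f₁ t‖ ≤ 4 * M * τ ^ 3 := by
  have hM0 : 0 ≤ M := (norm_nonneg _).trans (hM t ht)
  have hsub : Set.Icc (t - 2 * τ) t ⊆ s := hs.ordConnected.out ht' ht
  have hmaps (c : ℝ) (hc0 : 0 ≤ c) (hc2 : c ≤ 2) :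
      Set.MapsTo (fun h => t - c * h) (Set.Icc 0 τ) s := by
    intro h hh
    apply hsub
    constructor
    · nlinarith [hh.1, hh.2, mul_le_mul hc2 hh.2 hh.1 zero_le_two]
    · nlinarith [hh.1, hh.2, mul_nonneg hc0 hh.1]
  have hmem (h : ℝ) (hh : h ∈ Set.Icc 0 τ) : t - h ∈ s ∧ t - 2 * h ∈ s :=
    ⟨by simpa using hmaps 1 (by norm_num) (by norm_num) hh,
      hmaps 2 (by norm_num) (by norm_num) hh⟩
  have hchain (g g' : ℝ → E) (hg : ∀ x ∈ s, HasDerivWithinAt g (g' x) s x) (c : ℝ) (hc0 : 0 ≤ c)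
      (hc2 : c ≤ 2) (h : ℝ) (hh : h ∈ Set.Icc 0 τ) :
      HasDerivWithinAt (fun h => g (t - c * h)) ((-c) • g' (t - c * h)) (Set.Icc 0 τ) h := by
    have hd : HasDerivWithinAt (fun h : ℝ => t - c * h) (-c) (Set.Icc 0 τ) h := by
      simpa using (((hasDerivAt_id h).const_mul c).const_sub t).hasDerivWithinAt
    exact (hg _ (hmaps c hc0 hc2 hh)).scomp h hd (hmaps c hc0 hc2)
  have hchain₁ (g g' : ℝ → E) (hg : ∀ x ∈ s, HasDerivWithinAt g (g' x) s x) (h : ℝ)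
      (hh : h ∈ Set.Icc 0 τ) :
      HasDerivWithinAt (fun h => g (t - h)) ((-1 : ℝ) • g' (t - h)) (Set.Icc 0 τ) h := by
    simpa using hchain g g' hg 1 (by norm_num) (by norm_num) h hh
  have hchain₂ (g g' : ℝ → E) (hg : ∀ x ∈ s, HasDerivWithinAt g (g' x) s x) (h : ℝ)
      (hh : h ∈ Set.Icc 0 τ) :
      HasDerivWithinAt (fun h => g (t - 2 * h)) ((-2 : ℝ) • g' (t - 2 * h)) (Set.Icc 0 τ) h :=
    hchain g g' hg 2 (by norm_num) le_rfl h hh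
  -- the defect and its derivatives, as functions of the step size
  set G : ℝ → E := fun h => (3 : ℝ) • f t - (4 : ℝ) • f (t - h) + f (t - 2 * h) - (2 * h) • f₁ t
    with hG
  set G₁ : ℝ → E := fun h => (4 : ℝ) • f₁ (t - h) - (2 : ℝ) • f₁ (t - 2 * h) - (2 : ℝ) • f₁ t
    with hG₁
  set G₂ : ℝ → E := fun h => (4 : ℝ) • (f₂ (t - 2 * h) - f₂ (t - h)) with hG₂
  have hd₁ (h : ℝ) (hh : h ∈ Set.Icc 0 τ) : HasDerivWithinAt G (G₁ h) (Set.Icc 0 τ) h := by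
    have hlin : HasDerivWithinAt (fun h : ℝ => (2 * h) • f₁ t) ((2 : ℝ) • f₁ t)
        (Set.Icc 0 τ) h := by
      simpa using (((hasDerivAt_id h).const_mul (2 : ℝ)).smul_const (f₁ t)).hasDerivWithinAt
    have := ((((hchain₁ f f₁ h₁ h hh).const_smul (4 : ℝ)).const_sub ((3 : ℝ) • f t)).add
      (hchain₂ f f₁ h₁ h hh)).sub hlin
    refine this.congr_deriv ?_
    simp only [hG₁]
    module
  have hd₂ (h : ℝ) (hh : h ∈ Set.Icc 0 τ) : HasDerivWithinAt G₁ (G₂ h) (Set.Icc 0 τ) h := by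
    have := (((hchain₁ f₁ f₂ h₂ h hh).const_smul (4 : ℝ)).sub
      ((hchain₂ f₁ f₂ h₂ h hh).const_smul (2 : ℝ))).sub_const ((2 : ℝ) • f₁ t)
    refine this.congr_deriv ?_
    simp only [hG₂]
    module
  have hb₂ (h : ℝ) (hh : h ∈ Set.Icc 0 τ) : ‖G₂ h‖ ≤ 4 * M * τ := by
    have hmv := hs.norm_image_sub_le_of_norm_hasDerivWithin_le h₃ hM (hmem h hh).1 (hmem h hh).2
    have habs : ‖t - 2 * h - (t - h)‖ = h := by
      rw [show t - 2 * h - (t - h) = -h by ring, norm_neg, Real.norm_of_nonneg hh.1]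
    rw [habs] at hmv
    simp only [hG₂, norm_smul, Real.norm_ofNat]
    nlinarith [mul_le_mul_of_nonneg_left hh.2 hM0]
  have h0 : (0 : ℝ) ∈ Set.Icc 0 τ := ⟨le_rfl, hτ⟩
  have hb₁ (h : ℝ) (hh : h ∈ Set.Icc 0 τ) : ‖G₁ h‖ ≤ 4 * M * τ ^ 2 := by
    have hmv := (convex_Icc 0 τ).norm_image_sub_le_of_norm_hasDerivWithin_le hd₂ hb₂ h0 hh
    have hz : G₁ 0 = 0 := by
      simp only [hG₁, mul_zero, sub_zero]
      module
    rw [hz, sub_zero, sub_zero, Real.norm_of_nonneg hh.1] at hmv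
    nlinarith [mul_le_mul_of_nonneg_left hh.2 (by positivity : 0 ≤ 4 * M * τ)]
  have hmv := (convex_Icc 0 τ).norm_image_sub_le_of_norm_hasDerivWithin_le hd₁ hb₁ h0 ⟨hτ, le_rfl⟩
  have hz : G 0 = 0 := by
    simp only [hG, mul_zero, sub_zero]
    module
  rw [hz, sub_zero, sub_zero, Real.norm_of_nonneg hτ] at hmv
  calc ‖G τ‖ ≤ 4 * M * τ ^ 2 * τ := hmv
    _ = 4 * M * τ ^ 3 := by ring

lemma norm_bdf2_sub_derivWithin_le {f : ℝ → E} {a b : ℝ} (hab : a < b) {M : ℝ}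
    (hf : ContDiffOn ℝ 3 f (Set.Icc a b))
    (hM : ∀ x ∈ Set.Icc a b, ‖iteratedDerivWithin 3 f (Set.Icc a b) x‖ ≤ M) {t τ : ℝ} (hτ : 0 ≤ τ)
    (ht : t ≤ b) (ht' : a ≤ t - 2 * τ) :
    ‖(3 : ℝ) • f t - (4 : ℝ) • f (t - τ) + f (t - 2 * τ)
      - (2 * τ) • derivWithin f (Set.Icc a b) t‖ ≤ 4 * M * τ ^ 3 := by
  have hu : UniqueDiffOn ℝ (Set.Icc a b) := uniqueDiffOn_Icc hab
  have hder (m : ℕ) (hm : m < 3) (x : ℝ) (hx : x ∈ Set.Icc a b) :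
      HasDerivWithinAt (iteratedDerivWithin m f (Set.Icc a b))
        (iteratedDerivWithin (m + 1) f (Set.Icc a b) x) (Set.Icc a b) x := by
    rw [iteratedDerivWithin_succ]
    exact (hf.differentiableOn_iteratedDerivWithin (by exact_mod_cast hm) hu x hx).hasDerivWithinAt
  have hts : t ∈ Set.Icc a b := ⟨by linarith, ht⟩
  have := norm_bdf2_sub_deriv_le (convex_Icc a b) (hder 0 (by norm_num)) (hder 1 (by norm_num))
    (hder 2 (by norm_num)) hM hτ hts ⟨ht', by linarith⟩
  simpa only [iteratedDerivWithin_zero, zero_add, iteratedDerivWithin_one] using this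

end Consistency

section Energy

variable {H : Type*} [NormedAddCommGroup H] [InnerProductSpace ℝ H]

/-- The energy contributed by the delay terms to the BDF-2 energy. -/
noncomputable def delayEnergy (c : H →ₗ[ℝ] H →ₗ[ℝ] ℝ) (x₀ x₁ x₂ x₃ : H) : ℝ :=
  4 * c x₀ x₁ - 6 * c x₀ x₂ + 2 * c x₀ x₃ + 3 * c x₁ x₁ - 4 * c x₁ x₂ + 7 / 2 * c x₂ x₂
    - 2 * c x₂ x₃ + 1 / 2 * c x₃ x₃

/-- The discrete energy of the BDF-2 scheme with two delay terms. -/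
noncomputable def bdf2Energy (c : H →ₗ[ℝ] H →ₗ[ℝ] ℝ) (x₀ x₁ x₂ x₃ : H) : ℝ :=
  1 / 2 * ‖x₀‖ ^ 2 + 1 / 2 * ‖(2 : ℝ) • x₀ - x₁‖ ^ 2 + delayEnergy c x₀ x₁ x₂ x₃

lemma inner_bdf2_self (x₀ x₁ x₂ : H) :
    ⟪(3 : ℝ) • x₀ - (4 : ℝ) • x₁ + x₂, x₀⟫ =
      (1 / 2 * ‖x₀‖ ^ 2 + 1 / 2 * ‖(2 : ℝ) • x₀ - x₁‖ ^ 2)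
        - (1 / 2 * ‖x₁‖ ^ 2 + 1 / 2 * ‖(2 : ℝ) • x₁ - x₂‖ ^ 2)
        + 1 / 2 * ‖x₀ - (2 : ℝ) • x₁ + x₂‖ ^ 2 := by
  simp only [← real_inner_self_eq_norm_sq, inner_add_left, inner_sub_left, inner_add_right,
    inner_sub_right, real_inner_smul_left, real_inner_smul_right]
  rw [real_inner_comm x₀ x₁, real_inner_comm x₀ x₂, real_inner_comm x₁ x₂]
  ring

lemma delay_bdf2_self {c : H →ₗ[ℝ] H →ₗ[ℝ] ℝ} (hc : ∀ x y, c x y = c y x)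
    (x₀ x₁ x₂ x₃ x₄ : H) :
    2 * c ((3 : ℝ) • x₁ - (4 : ℝ) • x₂ + x₃) x₀ - c ((3 : ℝ) • x₂ - (4 : ℝ) • x₃ + x₄) x₀ =
      delayEnergy c x₀ x₁ x₂ x₃ - delayEnergy c x₁ x₂ x₃ x₄
        - 3 / 2 * c (x₀ - (2 : ℝ) • x₁ + x₂) (x₀ - (2 : ℝ) • x₁ + x₂)
        + c (x₀ - x₁ - x₂ + x₃) (x₀ - x₁ - x₂ + x₃)
        + 1 / 2 * c (x₀ - (2 : ℝ) • x₁ + (2 : ℝ) • x₃ - x₄)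
            (x₀ - (2 : ℝ) • x₁ + (2 : ℝ) • x₃ - x₄) := by
  simp only [delayEnergy, map_add, map_sub, map_smul, LinearMap.add_apply, LinearMap.sub_apply,
    LinearMap.smul_apply, smul_eq_mul]
  rw [hc x₁ x₀, hc x₂ x₀, hc x₃ x₀, hc x₄ x₀, hc x₂ x₁, hc x₃ x₁, hc x₄ x₁, hc x₃ x₂, hc x₄ x₃]
  ring

lemma delayEnergy_eq {c : H →ₗ[ℝ] H →ₗ[ℝ] ℝ} (hc : ∀ x y, c x y = c y x) (x₀ x₁ x₂ x₃ : H) :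
    delayEnergy c x₀ x₁ x₂ x₃ =
      1 / 2 * c (x₃ + (2 : ℝ) • x₀ - (2 : ℝ) • x₂) (x₃ + (2 : ℝ) • x₀ - (2 : ℝ) • x₂)
        + 1 / 6 * c ((3 : ℝ) • x₂ - (2 : ℝ) • x₀ - (4 : ℝ) • x₁)
            ((3 : ℝ) • x₂ - (2 : ℝ) • x₀ - (4 : ℝ) • x₁)
        + 1 / 102 * c ((17 : ℝ) • x₁ - (26 : ℝ) • x₀) ((17 : ℝ) • x₁ - (26 : ℝ) • x₀)
        + 12 / 17 * c x₀ x₀ - 5 / 2 * c ((2 : ℝ) • x₀ - x₁) ((2 : ℝ) • x₀ - x₁) := by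
  simp only [delayEnergy, map_add, map_sub, map_smul, LinearMap.add_apply, LinearMap.sub_apply,
    LinearMap.smul_apply, smul_eq_mul]
  rw [hc x₁ x₀, hc x₂ x₀, hc x₃ x₀, hc x₂ x₁, hc x₃ x₂]
  ring

variable {c : H →ₗ[ℝ] H →ₗ[ℝ] ℝ} {ω : ℝ}

lemma half_sq_norm_le_bdf2Energy (hc : ∀ x y, c x y = c y x)
    (hcω : ∀ x, 0 ≤ c x x ∧ c x x ≤ ω * ‖x‖ ^ 2) (hω : ω ≤ 1 / 5) (x₀ x₁ x₂ x₃ : H) :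
    1 / 2 * ‖x₀‖ ^ 2 ≤ bdf2Energy c x₀ x₁ x₂ x₃ := by
  rw [bdf2Energy, delayEnergy_eq hc]
  have h₁ := (hcω (x₃ + (2 : ℝ) • x₀ - (2 : ℝ) • x₂)).1
  have h₂ := (hcω ((3 : ℝ) • x₂ - (2 : ℝ) • x₀ - (4 : ℝ) • x₁)).1
  have h₃ := (hcω ((17 : ℝ) • x₁ - (26 : ℝ) • x₀)).1
  have h₄ := (hcω x₀).1
  have h₅ := (hcω ((2 : ℝ) • x₀ - x₁)).2
  have h₆ := mul_le_mul_of_nonneg_right hω (sq_nonneg ‖(2 : ℝ) • x₀ - x₁‖)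
  linarith

lemma bdf2Energy_sub_le (hc : ∀ x y, c x y = c y x)
    (hcω : ∀ x, 0 ≤ c x x ∧ c x x ≤ ω * ‖x‖ ^ 2) (hω : ω ≤ 1 / 5) (x₀ x₁ x₂ x₃ x₄ : H) :
    bdf2Energy c x₀ x₁ x₂ x₃ - bdf2Energy c x₁ x₂ x₃ x₄ ≤
      ⟪(3 : ℝ) • x₀ - (4 : ℝ) • x₁ + x₂, x₀⟫
        + 2 * c ((3 : ℝ) • x₁ - (4 : ℝ) • x₂ + x₃) x₀
        - c ((3 : ℝ) • x₂ - (4 : ℝ) • x₃ + x₄) x₀ := by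
  have h₁ := inner_bdf2_self x₀ x₁ x₂
  have h₂ := delay_bdf2_self hc x₀ x₁ x₂ x₃ x₄
  have h₃ := (hcω (x₀ - (2 : ℝ) • x₁ + x₂)).2
  have h₄ := mul_le_mul_of_nonneg_right hω (sq_nonneg ‖x₀ - (2 : ℝ) • x₁ + x₂‖)
  have h₅ := (hcω (x₀ - x₁ - x₂ + x₃)).1
  have h₆ := (hcω (x₀ - (2 : ℝ) • x₁ + (2 : ℝ) • x₃ - x₄)).1
  have h₇ := sq_nonneg ‖x₀ - (2 : ℝ) • x₁ + x₂‖
  simp only [bdf2Energy]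
  linarith

lemma two_mul_apply_le (hc : ∀ x y, c x y = c y x) (hc0 : ∀ x, 0 ≤ c x x) {s : ℝ} (hs : 0 < s)
    (x y : H) : 2 * c x y ≤ s * c x x + s⁻¹ * c y y := by
  have h := hc0 (s • x - y)
  simp only [map_sub, map_smul, LinearMap.sub_apply, LinearMap.smul_apply, smul_eq_mul] at h
  rw [hc y x] at h
  have h' := mul_nonneg (inv_pos.2 hs).le h
  have : s⁻¹ * (s * (s * c x x) - s * c x y - (s * c x y - c y y)) =
      s * c x x + s⁻¹ * c y y - 2 * c x y := by
    field_simp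
    ring
  linarith

lemma two_mul_inner_le {s : ℝ} (hs : 0 < s) (x y : H) :
    2 * ⟪x, y⟫ ≤ s * ‖x‖ ^ 2 + s⁻¹ * ‖y‖ ^ 2 := by
  have := two_mul_apply_le (c := innerₗ H) (fun x y => real_inner_comm y x)
    (fun x => real_inner_self_nonneg) hs x y
  simpa only [innerₗ_apply_apply, real_inner_self_eq_norm_sq] using this

/-- The consistency error is absorbed by the elliptic term, up to fifth order in `τ`. -/
lemma inner_add_apply_le (hc : ∀ x y, c x y = c y x)
    (hcω : ∀ x, 0 ≤ c x x ∧ c x x ≤ ω * ‖x‖ ^ 2) (hω : ω ≤ 1 / 5) {κ K τ M β : ℝ}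
    (hκ : 0 < κ) (hτ : 0 < τ) {ρ σ y : H} (hρ : ‖ρ‖ ≤ 4 * M * τ ^ 3)
    (hσ : ‖σ‖ ≤ 12 * M * τ ^ 3) (hK : 0 < K) (hy : ‖y‖ ^ 2 ≤ K * β) :
    ⟪ρ, y⟫ + c σ y ≤ τ * (κ * β) + 23 * M ^ 2 * K / κ * τ ^ 5 := by
  have hs : 0 < K / (τ * κ) := by positivity
  have h₁ := two_mul_inner_le hs ρ y
  have h₂ := two_mul_apply_le hc (fun x => (hcω x).1) hs σ y
  have hρ2 : ‖ρ‖ ^ 2 ≤ (4 * M * τ ^ 3) ^ 2 := pow_le_pow_left₀ (norm_nonneg _) hρ 2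
  have hσ2 : ‖σ‖ ^ 2 ≤ (12 * M * τ ^ 3) ^ 2 := pow_le_pow_left₀ (norm_nonneg _) hσ 2
  have hcσ : c σ σ ≤ 1 / 5 * (12 * M * τ ^ 3) ^ 2 :=
    (hcω σ).2.trans ((mul_le_mul_of_nonneg_right hω (sq_nonneg _)).trans
      (mul_le_mul_of_nonneg_left hσ2 (by norm_num)))
  have hcy : ‖y‖ ^ 2 + c y y ≤ 2 * (K * β) := by
    have := (hcω y).2
    have := mul_le_mul_of_nonneg_right hω (sq_nonneg ‖y‖)
    nlinarith [sq_nonneg ‖y‖]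
  have hdata : ‖ρ‖ ^ 2 + c σ σ ≤ 46 * M ^ 2 * τ ^ 6 := by
    nlinarith [sq_nonneg (M * τ ^ 3)]
  have h₃ := mul_le_mul_of_nonneg_left hcy (inv_pos.2 hs).le
  have h₄ := mul_le_mul_of_nonneg_left hdata hs.le
  have e₃ : (K / (τ * κ))⁻¹ * (2 * (K * β)) = 2 * (τ * (κ * β)) := by
    field_simp
  have e₄ : K / (τ * κ) * (46 * M ^ 2 * τ ^ 6) = 2 * (23 * M ^ 2 * K / κ * τ ^ 5) := by
    field_simp
    ring
  linarith

end Energy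

/-- Theorem 4.2: second-order convergence of the BDF-2 scheme applied to the neutral delay
operator equation `ż + B̃z + C̃(2ż(·-τ) - ż(·-2τ)) = r` in a Gelfand-triple setting, with a
constant depending only on the ellipticity constant `c_b`, the norm bound `Cι` of the
embedding, the coupling constant `ω ≤ 1/5`, and the bound `M₃` on the third derivative. -/
theorem bdf2_delay_convergence (c_b Cι ω M₃ : ℝ) (hcb : 0 < c_b) (hω0 : 0 ≤ ω)
    (hω : ω ≤ 1 / 5) :
    ∃ C : ℝ, 0 < C ∧
      ∀ (Q : Type u) (H : Type v)
        [NormedAddCommGroup Q] [InnerProductSpace ℝ Q] [CompleteSpace Q]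
        [NormedAddCommGroup H] [InnerProductSpace ℝ H] [CompleteSpace H]
        (ι : Q →L[ℝ] H), Function.Injective ι → ‖ι‖ ≤ Cι →
      ∀ btil : Q →ₗ[ℝ] Q →ₗ[ℝ] ℝ,
        (∀ q r, btil q r = btil r q) →
        (∀ q : Q, c_b * ‖q‖ ^ 2 ≤ btil q q) →
        (∃ Cb : ℝ, ∀ q r : Q, |btil q r| ≤ Cb * ‖q‖ * ‖r‖) →
      ∀ ctil : H →ₗ[ℝ] H →ₗ[ℝ] ℝ,
        (∀ x y, ctil x y = ctil y x) →
        (∀ x : H, 0 ≤ ctil x x ∧ ctil x x ≤ ω * ‖x‖ ^ 2) →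
      ∀ τ : ℝ, 0 < τ → τ ≤ 1 →
      ∀ (N : ℕ) (T : ℝ), T = N * τ →
      ∀ (r : ℝ → H) (z : ℝ → Q),
        ContDiffOn ℝ 3 (fun s => ι (z s)) (Set.Icc (-(2 * τ)) T) →
        (∀ s ∈ Set.Icc (-(2 * τ)) T,
          ‖iteratedDerivWithin 3 (fun s => ι (z s)) (Set.Icc (-(2 * τ)) T) s‖ ≤ M₃) →
        (∀ t ∈ Set.Icc (0 : ℝ) T, ∀ q : Q,
          ⟪derivWithin (fun s => ι (z s)) (Set.Icc (-(2 * τ)) T) t, ι q⟫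
            + btil (z t) q
            + ctil ((2 : ℝ) • derivWithin (fun s => ι (z s)) (Set.Icc (-(2 * τ)) T) (t - τ)
                - derivWithin (fun s => ι (z s)) (Set.Icc (-(2 * τ)) T) (t - 2 * τ)) (ι q)
          = ⟪r t, ι q⟫) →
      ∀ zn : ℤ → Q,
        zn 0 = z 0 → zn (-1) = z (-τ) → zn (-2) = z (-(2 * τ)) →
        (∀ (n : ℕ) (q : Q),
          ⟪ι ((3 : ℝ) • zn ((n : ℤ) + 2) - (4 : ℝ) • zn ((n : ℤ) + 1) + zn (n : ℤ)), ι q⟫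
            + 2 * τ * btil (zn ((n : ℤ) + 2)) q
            + 2 * ctil (ι ((3 : ℝ) • zn ((n : ℤ) + 1) - (4 : ℝ) • zn (n : ℤ)
                + zn ((n : ℤ) - 1))) (ι q)
            - ctil (ι ((3 : ℝ) • zn (n : ℤ) - (4 : ℝ) • zn ((n : ℤ) - 1)
                + zn ((n : ℤ) - 2))) (ι q)
          = 2 * τ * ⟪r (((n : ℝ) + 2) * τ), ι q⟫) →
      ∀ n : ℕ, 2 ≤ n → n ≤ N →
        ‖ι (z ((n : ℝ) * τ) - zn (n : ℤ))‖ ^ 2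
            + τ * ∑ j ∈ Finset.Icc 2 n, ‖z ((j : ℝ) * τ) - zn (j : ℤ)‖ ^ 2
          ≤ C * ((n : ℝ) * τ * τ ^ 4
              + (‖ι (z τ - zn 1)‖ ^ 2 + τ * ‖z τ - zn 1‖ ^ 2)) := by
  set K : ℝ := 23 * M₃ ^ 2 * (Cι ^ 2 + 1) / c_b with hK
  have hK0 : 0 ≤ K := by positivity
  refine ⟨(2 + 1 / c_b) * (5 / 2 + K), by positivity, ?_⟩
  intro Q H _ _ _ _ _ _ ι _ hιn btil _ hbell _ ctil hcsymm hcω τ hτ _ N T hT r z hz hM heq zn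
    hz0 hz1 hz2 hscheme n hn2 hnN
  set f : ℝ → H := fun s => ι (z s) with hf
  set f' : ℝ → H := derivWithin f (Set.Icc (-(2 * τ)) T) with hf'
  set e : ℤ → Q := fun k => z ((k : ℝ) * τ) - zn k with he
  have hT0 : 0 ≤ T := by rw [hT]; positivity
  have he0 : e 0 = 0 := by simp [he, hz0]
  have he1 : e (-1) = 0 := by simp [he, hz1]
  have he2 : e (-2) = 0 := by simp [he, hz2]
  set defect : ℝ → H := fun t =>
    (3 : ℝ) • f t - (4 : ℝ) • f (t - τ) + f (t - 2 * τ) - (2 * τ) • f' t with hdefect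
  have hdef (t : ℝ) (ht0 : 0 ≤ t) (htT : t ≤ T) : ‖defect t‖ ≤ 4 * M₃ * τ ^ 3 :=
    norm_bdf2_sub_derivWithin_le (by linarith) hz hM hτ.le htT (by linarith)
  have herr (m : ℕ) (hm : m + 2 ≤ N) (q : Q) :
      ⟪(3 : ℝ) • ι (e (m + 2)) - (4 : ℝ) • ι (e (m + 1)) + ι (e m), ι q⟫
        + 2 * ctil ((3 : ℝ) • ι (e (m + 1)) - (4 : ℝ) • ι (e m) + ι (e (m - 1))) (ι q)
        - ctil ((3 : ℝ) • ι (e m) - (4 : ℝ) • ι (e (m - 1)) + ι (e (m - 2))) (ι q)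
        + 2 * τ * btil (e (m + 2)) q
      = ⟪defect ((m + 2) * τ), ι q⟫
        + ctil ((2 : ℝ) • defect ((m + 1) * τ) - defect (m * τ)) (ι q) := by
    have hmem : ((m : ℝ) + 2) * τ ∈ Set.Icc 0 T := by
      refine ⟨by positivity, ?_⟩
      rw [hT]
      exact mul_le_mul_of_nonneg_right (by exact_mod_cast hm) hτ.le
    have h₁ := heq _ hmem q
    have h₂ := hscheme m q
    have g₁ : ((m : ℝ) + 2) * τ - τ = (m + 1) * τ := by ring
    have g₂ : ((m : ℝ) + 2) * τ - 2 * τ = m * τ := by ring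
    have g₃ : ((m : ℝ) + 1) * τ - τ = m * τ := by ring
    have g₄ : ((m : ℝ) + 1) * τ - 2 * τ = (m - 1) * τ := by ring
    have g₅ : (m : ℝ) * τ - τ = (m - 1) * τ := by ring
    have g₆ : (m : ℝ) * τ - 2 * τ = (m - 2) * τ := by ring
    simp only [hdefect, he, hf, g₁, g₂, g₃, g₄, g₅, g₆, Int.cast_add, Int.cast_sub,
      Int.cast_natCast, Int.cast_one, Int.cast_ofNat, map_add, map_sub, map_smul, inner_add_left,
      inner_sub_left, real_inner_smul_left, LinearMap.add_apply, LinearMap.sub_apply,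
      LinearMap.smul_apply, smul_eq_mul] at h₁ h₂ ⊢
    linear_combination (2 * τ) * h₁ - h₂
  have hιe (q : Q) : ‖ι q‖ ^ 2 ≤ (Cι ^ 2 + 1) * ‖q‖ ^ 2 := by
    have h : ‖ι q‖ ≤ Cι * ‖q‖ := ι.le_of_opNorm_le hιn q
    nlinarith [pow_le_pow_left₀ (norm_nonneg _) h 2, sq_nonneg ‖q‖]
  have hstep (m : ℕ) (hm : m + 2 ≤ N) :
      bdf2Energy ctil (ι (e (m + 2))) (ι (e (m + 1))) (ι (e m)) (ι (e (m - 1)))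
          + τ * (c_b * ‖e (m + 2)‖ ^ 2)
        ≤ bdf2Energy ctil (ι (e (m + 1))) (ι (e m)) (ι (e (m - 1))) (ι (e (m - 2)))
          + K * τ ^ 5 := by
    have hle {k : ℝ} (hk : k ≤ m + 2) : k * τ ≤ T := by
      rw [hT]
      exact mul_le_mul_of_nonneg_right (hk.trans (by exact_mod_cast hm)) hτ.le
    have hρ := hdef ((m + 2) * τ) (by positivity) (hle le_rfl)
    have hσ : ‖(2 : ℝ) • defect ((m + 1) * τ) - defect (m * τ)‖ ≤ 12 * M₃ * τ ^ 3 := by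
      have h₁ := hdef ((m + 1) * τ) (by positivity) (hle (by linarith))
      have h₀ := hdef (m * τ) (by positivity) (hle (by linarith))
      calc _ ≤ ‖(2 : ℝ) • defect ((m + 1) * τ)‖ + ‖defect (m * τ)‖ := norm_sub_le _ _
        _ = 2 * ‖defect ((m + 1) * τ)‖ + ‖defect (m * τ)‖ := by rw [norm_smul, Real.norm_ofNat]
        _ ≤ _ := by linarith
    have h₁ := inner_add_apply_le hcsymm hcω hω hcb hτ hρ hσ (by positivity) (hιe (e (m + 2)))
    have h₂ := bdf2Energy_sub_le hcsymm hcω hω (ι (e (m + 2))) (ι (e (m + 1))) (ι (e m))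
      (ι (e (m - 1))) (ι (e (m - 2)))
    have h₃ := herr m hm (e (m + 2))
    have h₄ := mul_le_mul_of_nonneg_left (hbell (e (m + 2))) hτ.le
    linarith
  have hind (m : ℕ) (hm : m + 1 ≤ N) :
      bdf2Energy ctil (ι (e (m + 1))) (ι (e m)) (ι (e (m - 1))) (ι (e (m - 2)))
          + τ * (c_b * ∑ j ∈ Finset.Icc 2 (m + 1), ‖e j‖ ^ 2)
        ≤ 5 / 2 * ‖ι (e 1)‖ ^ 2 + m * (K * τ ^ 5) := by
    induction m with
    | zero =>
      have h : ‖(2 : ℝ) • ι (e 1)‖ = 2 * ‖ι (e 1)‖ := by rw [norm_smul, Real.norm_ofNat]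
      simp only [Nat.cast_zero, zero_add, zero_sub, he0, he1, he2, map_zero, bdf2Energy,
        delayEnergy, sub_zero, h]
      norm_num
      nlinarith [sq_nonneg ‖ι (e 1)‖]
    | succ m ih =>
      have h₁ := ih (by omega)
      have h₂ := hstep m (by omega)
      rw [Finset.sum_Icc_succ_top (by omega : 2 ≤ m + 1 + 1)]
      push_cast
      rw [show (m : ℤ) + 1 + 1 = m + 2 by ring, show (m : ℤ) + 1 - 1 = m by ring,
        show (m : ℤ) + 1 - 2 = m - 1 by ring]
      linarith
  obtain ⟨m, rfl⟩ : ∃ m, n = m + 1 := ⟨n - 1, by omega⟩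
  have h₁ := hind m hnN
  have h₂ := half_sq_norm_le_bdf2Energy hcsymm hcω hω (ι (e (m + 1))) (ι (e m))
    (ι (e (m - 1))) (ι (e (m - 2)))
  have hgoal₁ : z (((m + 1 : ℕ) : ℝ) * τ) - zn ((m + 1 : ℕ) : ℤ) = e (m + 1) := by simp [he]
  have hgoal₂ (j : ℕ) : z ((j : ℝ) * τ) - zn (j : ℤ) = e j := by simp [he]
  have hgoal₃ : z τ - zn 1 = e 1 := by simp [he]
  simp only [hgoal₁, hgoal₂, hgoal₃]
  set S : ℝ := ∑ j ∈ Finset.Icc 2 (m + 1), ‖e j‖ ^ 2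
  have hS : 0 ≤ S := Finset.sum_nonneg fun _ _ => sq_nonneg _
  have h₃ : 1 / 2 * ‖ι (e (m + 1))‖ ^ 2 + τ * (c_b * S) ≤
      (5 / 2 + K) * (((m + 1 : ℕ) : ℝ) * τ * τ ^ 4
        + (‖ι (e 1)‖ ^ 2 + τ * ‖e 1‖ ^ 2)) := by
    have p₁ : 0 ≤ τ ^ 5 := by positivity
    have p₂ : 0 ≤ (m : ℝ) * τ ^ 5 := by positivity
    have p₃ : 0 ≤ K * τ ^ 5 := by positivity
    have p₄ : 0 ≤ K * ‖ι (e 1)‖ ^ 2 := by positivity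
    have p₅ : 0 ≤ (5 / 2 + K) * (τ * ‖e 1‖ ^ 2) := by positivity
    push_cast
    linarith
  have h₄ := mul_le_mul_of_nonneg_left h₃ (by positivity : 0 ≤ 2 + 1 / c_b)
  have h₅ : (2 + 1 / c_b) * (1 / 2 * ‖ι (e (m + 1))‖ ^ 2 + τ * (c_b * S)) =
      ‖ι (e (m + 1))‖ ^ 2 + τ * S + (1 / (2 * c_b) * ‖ι (e (m + 1))‖ ^ 2
        + 2 * (τ * (c_b * S))) := by
    field_simp
    ring
  have h₆ : 0 ≤ 1 / (2 * c_b) * ‖ι (e (m + 1))‖ ^ 2 + 2 * (τ * (c_b * S)) := by positivity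
  rw [mul_assoc]
  linarith
end

section
/- Let V, Q, H be real Hilbert spaces and let ι : Q → H be an injective bounded linear map. Let a : V × V → ℝ be a symmetric bounded bilinear form with a(v,v) ≥ c_a‖v‖_V² (c_a > 0), let b : Q × Q → ℝ be a symmetric bounded bilinear form with b(q,q) ≥ c_b‖q‖_Q² (c_b > 0), let c : H × H → ℝ be a symmetric bounded bilinear form with c(h,h) ≥ c_c‖h‖_H² (c_c > 0), and let d : V × H → ℝ be a bilinear form with |d(v,h)| ≤ C_d‖v‖_V‖h‖_H. Let k ≥ 1 be an integer, τ > 0, T > 0, let f : [0,T] → V* be continuously differentiable and g : [0,T] → Q* arbitrary. Suppose u, ū : [0,T] → V are continuously differentiable, p : [0,T] → Q and p̄ : [−τ, T] → Q are such that ι∘p is continuously differentiable and ι∘p̄ is (k+1)-times continuously differentiable, and that for all t ∈ [0,T], all v ∈ V and all q ∈ Q: (i) a(u(t),v) − d(v, ι p(t)) = f(t)(v) and d(u'(t), ιq) + c((ι∘p)'(t), ιq) + b(p(t), q) = g(t)(q); (ii) a(ū(t),v) − d(v, Σ_{j=0}^{k−1} (τ^j/j!)·(ι∘p̄)^{(j)}(t−τ))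 = f(t)(v) and d(ū'(t), ιq) + c((ι∘p̄)'(t), ιq) + b(p̄(t), q) = g(t)(q). Assume the history conditions p̄(−τ) = p̄(0) = p(0) and (ι∘p̄)^{(j)}(−τ) = 0 for j = 1, …, k−1. Then there exists a constant C > 0, depending only on k and the ellipticity and continuity constants of a, b, c, d, such that for all t ∈ [0,T]: ‖p̄(t) − p(t)‖_Q² + ‖ū(t) − u(t)‖_V² ≤ C·t·τ^{2k}·( M_k² + M_{k+1}² ), where M_j := sup_{s ∈ [−τ,T]} ‖(ι∘p̄)^{(j)}(s)‖_H. -/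
open Set Filter Topology

/-- The Taylor sum of order `n` at time `t - τ`, evaluated at `t`, with derivatives within `s`. -/
noncomputable def delayTaylorSum {E : Type*} [NormedAddCommGroup E] [NormedSpace ℝ E]
    (n : ℕ) (G : ℝ → E) (s : Set ℝ) (τ t : ℝ) : E :=
  ∑ j ∈ Finset.range n, (τ ^ j / (Nat.factorial j : ℝ)) • iteratedDerivWithin j G s (t - τ)

theorem iteratedDerivWithin_subset {E : Type*} [NormedAddCommGroup E] [NormedSpace ℝ E]
    {n : ℕ} {G : ℝ → E} {s t : Set ℝ} {x : ℝ} (st : s ⊆ t) (hs : UniqueDiffOn ℝ s)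
    (ht : UniqueDiffOn ℝ t) (h : ContDiffOn ℝ n G t) (hx : x ∈ s) :
    iteratedDerivWithin n G s x = iteratedDerivWithin n G t x := by
  rw [iteratedDerivWithin_eq_iteratedFDerivWithin, iteratedDerivWithin_eq_iteratedFDerivWithin,
    iteratedFDerivWithin_subset st hs ht h hx]

theorem norm_sub_delayTaylorSum_le {E : Type*} [NormedAddCommGroup E] [NormedSpace ℝ E]
    {n : ℕ} (hn : 1 ≤ n) {G : ℝ → E} {α β τ t M : ℝ} (hτ : 0 < τ)
    (hG : ContDiffOn ℝ n G (Icc α β)) (hα : α ≤ t - τ) (hβ : t ≤ β)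
    (hM : ∀ s ∈ Icc α β, ‖iteratedDerivWithin n G (Icc α β) s‖ ≤ M) :
    ‖G t - delayTaylorSum n G (Icc α β) τ t‖ ≤ τ ^ n * M := by
  obtain ⟨m, rfl⟩ := Nat.exists_eq_add_of_le' hn
  have hsub : Icc (t - τ) β ⊆ Icc α β := Icc_subset_Icc_left hα
  have hs : UniqueDiffOn ℝ (Icc (t - τ) β) := uniqueDiffOn_Icc (by linarith)
  have hs' : UniqueDiffOn ℝ (Icc α β) := uniqueDiffOn_Icc (by linarith)
  have hM0 : 0 ≤ M := (norm_nonneg _).trans (hM t ⟨by linarith, hβ⟩)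
  have key := taylor_mean_remainder_bound (f := G) (a := t - τ) (b := β) (C := M) (x := t)
    (n := m) (by linarith) (by exact_mod_cast hG.mono hsub) ⟨by linarith, hβ⟩ (fun y hy => by
      rw [iteratedDerivWithin_subset hsub hs hs' hG hy]
      exact hM y (hsub hy))
  have hsum : taylorWithinEval G m (Icc (t - τ) β) (t - τ) t
      = delayTaylorSum (m + 1) G (Icc α β) τ t := by
    rw [taylor_within_apply, delayTaylorSum]
    refine Finset.sum_congr rfl fun j hj => ?_
    have hj' : j ≤ m + 1 := (Finset.mem_range.1 hj).le
    rw [iteratedDerivWithin_subset hsub hs hs' (hG.of_le (by exact_mod_cast hj'))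
      ⟨le_rfl, by linarith⟩, sub_sub_cancel, div_eq_inv_mul]
  rw [hsum, sub_sub_cancel] at key
  refine key.trans ((div_le_self (by positivity) ?_).trans_eq (mul_comm _ _))
  exact_mod_cast Nat.succ_le_of_lt (Nat.factorial_pos m)

theorem hasDerivWithinAt_delayTaylorSum {E : Type*} [NormedAddCommGroup E] [NormedSpace ℝ E]
    {n : ℕ} {G : ℝ → E} {s r : Set ℝ} {τ t : ℝ} (hs : UniqueDiffOn ℝ s)
    (hG : ContDiffOn ℝ n G s) (hr : MapsTo (fun x => x - τ) r s) (ht : t ∈ r) :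
    HasDerivWithinAt (delayTaylorSum n G s τ) (delayTaylorSum n (derivWithin G s) s τ t) r t := by
  refine HasDerivWithinAt.fun_sum fun j hj => HasDerivWithinAt.const_smul _ ?_
  have hj' : j < n := Finset.mem_range.1 hj
  have h1 := (hG.differentiableOn_iteratedDerivWithin (by exact_mod_cast hj') hs
    (t - τ) (hr ht)).hasDerivWithinAt
  rw [← iteratedDerivWithin_succ, iteratedDerivWithin_succ'] at h1
  simpa [Function.comp_def] using
    h1.scomp t ((hasDerivWithinAt_id t r).sub_const τ) hr

/-- A function whose increments are `(F y + F x) (η y - η x)`, with `F` continuous and `η`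
differentiable, is differentiable with derivative `2 F η'`. -/
theorem hasDerivWithinAt_of_sub_eq_add_apply_sub {E : Type*} [NormedAddCommGroup E]
    [NormedSpace ℝ E] {β : ℝ → ℝ} {F : ℝ → E →L[ℝ] ℝ} {η : ℝ → E} {η' : E} {s : Set ℝ} {x : ℝ}
    (hF : ContinuousWithinAt F s x) (hη : HasDerivWithinAt η η' s x)
    (h : ∀ y ∈ s, β y - β x = (F y + F x) (η y - η x)) :
    HasDerivWithinAt β (2 * F x η') s x := by
  rw [hasDerivWithinAt_iff_tendsto_slope] at hη ⊢
  have hF' : Tendsto (fun y => F y + F x) (𝓝[s \ {x}] x) (𝓝 (F x + F x)) :=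
    (hF.mono_left (nhdsWithin_mono x sdiff_subset)).add_const _
  have hlim := ((isBoundedBilinearMap_apply (𝕜 := ℝ) (E := E) (F := ℝ)).continuous.tendsto
    (F x + F x, η')).comp (hF'.prodMk_nhds hη)
  rw [add_apply, ← two_mul] at hlim
  refine hlim.congr' ?_
  filter_upwards [self_mem_nhdsWithin] with y hy
  simp only [Function.comp_apply, slope, vsub_eq_sub, map_smul, h y hy.1]

/-- Growth bound for a function with bounded derivative within an interval. -/
theorem le_add_mul_of_hasDerivWithinAt_le {E E' : ℝ → ℝ} {T K : ℝ}
    (hE : ∀ t ∈ Icc 0 T, HasDerivWithinAt E (E' t) (Icc 0 T) t)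
    (hK : ∀ t ∈ Icc 0 T, E' t ≤ K) {t : ℝ} (ht : t ∈ Icc 0 T) : E t ≤ E 0 + K * t := by
  have hd : ∀ x ∈ interior (Icc 0 T), HasDerivAt E (E' x) x := fun x hx =>
    (hE x (interior_subset hx)).hasDerivAt (mem_interior_iff_mem_nhds.1 hx)
  have := (convex_Icc 0 T).image_sub_le_mul_sub_of_deriv_le
    (fun x hx => (hE x hx).continuousWithinAt)
    (fun x hx => (hd x hx).differentiableAt.differentiableWithinAt) (C := K)
    (fun x hx => (hd x hx).deriv.trans_le (hK x (interior_subset hx)))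
    0 ⟨le_rfl, ht.1.trans ht.2⟩ t ht ht.1
  linarith

section EnergyEstimate

variable {V Q H : Type*} [NormedAddCommGroup V] [NormedSpace ℝ V]
  [NormedAddCommGroup Q] [NormedSpace ℝ Q] [NormedAddCommGroup H] [NormedSpace ℝ H]

/-- Energy estimate for the elliptic-parabolic error system with perturbation `R` in the
elliptic equation. -/
theorem elliptic_parabolic_energy_estimate
    {c_a c_b C_d : ℝ} (hca : 0 < c_a) (hcb : 0 < c_b) {ι : Q →L[ℝ] H}
    {a : V →L[ℝ] V →L[ℝ] ℝ} (ha : ∀ v w, a v w = a w v) (ha' : ∀ v, c_a * ‖v‖ ^ 2 ≤ a v v)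
    {b : Q →ₗ[ℝ] Q →ₗ[ℝ] ℝ} (hb : ∀ q r, b q r = b r q) (hb' : ∀ q, c_b * ‖q‖ ^ 2 ≤ b q q)
    {c : H →L[ℝ] H →L[ℝ] ℝ} (hc : ∀ x y, c x y = c y x) (hc' : ∀ x, 0 ≤ c x x)
    {d : V →L[ℝ] H →L[ℝ] ℝ} (hd : ∀ v x, |d v x| ≤ C_d * ‖v‖ * ‖x‖)
    {T : ℝ} (hT : 0 < T) {e e' : ℝ → V} {q : ℝ → Q} {η' R R' : ℝ → H}
    (he : ∀ t ∈ Icc 0 T, HasDerivWithinAt e (e' t) (Icc 0 T) t)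
    (hη : ∀ t ∈ Icc 0 T, HasDerivWithinAt (fun s => ι (q s)) (η' t) (Icc 0 T) t)
    (hR : ∀ t ∈ Icc 0 T, HasDerivWithinAt R (R' t) (Icc 0 T) t)
    (hec : ContinuousOn e' (Icc 0 T)) (hηc : ContinuousOn η' (Icc 0 T))
    (hell : ∀ t ∈ Icc 0 T, ∀ v, a (e t) v = d v (ι (q t) - R t))
    (hpar : ∀ t ∈ Icc 0 T, ∀ r, d (e' t) (ι r) + c (η' t) (ι r) + b (q t) r = 0)
    (he0 : e 0 = 0) (hq0 : q 0 = 0) {m m' : ℝ}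
    (hm : ∀ t ∈ Icc 0 T, ‖R t‖ ≤ m) (hm' : ∀ t ∈ Icc 0 T, ‖R' t‖ ≤ m')
    {t : ℝ} (ht : t ∈ Icc 0 T) :
    c_a * ‖e t‖ ^ 2 + c_b * ‖q t‖ ^ 2 ≤ C_d ^ 2 / c_a * t * (m ^ 2 + m' ^ 2) := by
  have hell' : ∀ t ∈ Icc 0 T, ∀ v, a (e' t) v = d v (η' t - R' t) := fun t ht v => by
    have h1 := (a.flip v).hasFDerivAt.comp_hasDerivWithinAt t (he t ht)
    have h2 := (d v).hasFDerivAt.comp_hasDerivWithinAt t ((hη t ht).sub (hR t ht))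
    refine UniqueDiffWithinAt.eq_deriv _ (uniqueDiffOn_Icc hT t ht) h1 (h2.congr (fun s hs => ?_) ?_)
    · exact hell s hs v
    · exact hell t ht v
  have hβ : ∀ t ∈ Icc 0 T, HasDerivWithinAt (fun s => b (q s) (q s))
      (2 * (-(d (e' t)) - c (η' t)) (η' t)) (Icc 0 T) t := fun t ht => by
    refine hasDerivWithinAt_of_sub_eq_add_apply_sub (F := fun s => -(d (e' s)) - c (η' s))
      (η := fun s => ι (q s)) ?_ (hη t ht) fun s hs => ?_
    · exact ((d.continuous.comp_continuousOn hec).neg.sub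
        (c.continuous.comp_continuousOn hηc)) t ht
    · have h1 := hpar s hs (q s - q t)
      have h2 := hpar t ht (q s - q t)
      have h3 := hb (q s) (q t)
      simp only [map_sub, add_apply, sub_apply,
        neg_apply] at h1 h2 ⊢
      linarith
  have hE : ∀ t ∈ Icc 0 T, HasDerivWithinAt
      (fun s => a (e s) (e s) + c (ι (q s)) (ι (q s)) + b (q s) (q s))
      (a (e' t) (e t) + a (e t) (e' t) + (c (η' t) (ι (q t)) + c (ι (q t)) (η' t))
        + 2 * (-(d (e' t)) - c (η' t)) (η' t)) (Icc 0 T) t := fun t ht =>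
    (((a.hasFDerivAt.comp_hasDerivWithinAt t (he t ht)).clm_apply (he t ht)).add
      ((c.hasFDerivAt.comp_hasDerivWithinAt t (hη t ht)).clm_apply (hη t ht))).add (hβ t ht)
  have hK : ∀ t ∈ Icc 0 T, a (e' t) (e t) + a (e t) (e' t)
      + (c (η' t) (ι (q t)) + c (ι (q t)) (η' t)) + 2 * (-(d (e' t)) - c (η' t)) (η' t)
      ≤ C_d ^ 2 / c_a * (m ^ 2 + m' ^ 2) := fun t ht => by
    have h1 := hell t ht (e' t)
    have h2 := hell' t ht (e' t)
    have h3 := hpar t ht (q t)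
    have hdR : ∀ (x : H) (r : ℝ), ‖x‖ ≤ r → -(2 * d (e' t) x)
        ≤ c_a * ‖e' t‖ ^ 2 + C_d ^ 2 / c_a * r ^ 2 := fun x r hx => by
      have hr : 0 ≤ r := (norm_nonneg x).trans hx
      have h4 : -(d (e' t) x) ≤ |C_d| * ‖e' t‖ * r :=
        (neg_le_abs _).trans ((hd _ _).trans (by gcongr; exact le_abs_self _))
      have h5 : c_a * ‖e' t‖ ^ 2 + C_d ^ 2 / c_a * r ^ 2 - 2 * (|C_d| * ‖e' t‖ * r)
          = (c_a * ‖e' t‖ - |C_d| * r) ^ 2 / c_a := by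
        rw [← sq_abs C_d]
        field_simp
        ring
      have h6 : 0 ≤ (c_a * ‖e' t‖ - |C_d| * r) ^ 2 / c_a := by positivity
      linarith
    have h4 := hdR _ _ (hm t ht)
    have h5 := hdR _ _ (hm' t ht)
    have h6 := ha (e' t) (e t)
    have h7 := hc (ι (q t)) (η' t)
    have h8 := hc' (η' t)
    have h9 : 0 ≤ b (q t) (q t) := le_trans (by positivity) (hb' (q t))
    have h10 := ha' (e' t)
    simp only [map_sub, sub_apply, neg_apply] at h1 h2 ⊢
    linarith
  have key := le_add_mul_of_hasDerivWithinAt_le hE hK ht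
  simp only [he0, hq0, map_zero, add_zero, zero_add] at key
  have h1 := ha' (e t)
  have h2 := hb' (q t)
  have h3 := hc' (ι (q t))
  linarith

end EnergyEstimate

universe u v w

/-- Proposition A.1: the solution `(ū, p̄)` of the delay system obtained by replacing the
pressure in the elliptic equation by its order-`k` Taylor expansion at time `t - τ` differs
from the solution `(u, p)` of the coupled system only by a term of order `τ^k`, with a
constant depending only on `k` and the ellipticity and continuity constants of the bilinear
forms `a`, `b`, `c`, `d`. -/
theorem delay_system_taylor_approximation
    (k : ℕ) (hk : 1 ≤ k)
    (c_a C_a c_b C_b c_c C_c C_d : ℝ) (hca : 0 < c_a) (hcb : 0 < c_b) (hcc : 0 < c_c) :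
    ∃ C : ℝ, 0 < C ∧
      ∀ (V : Type u) (Q : Type v) (H : Type w)
        [NormedAddCommGroup V] [InnerProductSpace ℝ V] [CompleteSpace V]
        [NormedAddCommGroup Q] [InnerProductSpace ℝ Q] [CompleteSpace Q]
        [NormedAddCommGroup H] [InnerProductSpace ℝ H] [CompleteSpace H]
        (ι : Q →L[ℝ] H), Function.Injective ι →
      ∀ a : V →ₗ[ℝ] V →ₗ[ℝ] ℝ, (∀ v w, a v w = a w v) →
        (∀ v : V, c_a * ‖v‖ ^ 2 ≤ a v v) → (∀ v w : V, |a v w| ≤ C_a * ‖v‖ * ‖w‖) →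
      ∀ b : Q →ₗ[ℝ] Q →ₗ[ℝ] ℝ, (∀ q r, b q r = b r q) →
        (∀ q : Q, c_b * ‖q‖ ^ 2 ≤ b q q) → (∀ q r : Q, |b q r| ≤ C_b * ‖q‖ * ‖r‖) →
      ∀ c : H →ₗ[ℝ] H →ₗ[ℝ] ℝ, (∀ x y, c x y = c y x) →
        (∀ x : H, c_c * ‖x‖ ^ 2 ≤ c x x) → (∀ x y : H, |c x y| ≤ C_c * ‖x‖ * ‖y‖) →
      ∀ d : V →ₗ[ℝ] H →ₗ[ℝ] ℝ, (∀ (v : V) (x : H), |d v x| ≤ C_d * ‖v‖ * ‖x‖) →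
      ∀ τ T : ℝ, 0 < τ → 0 < T →
      ∀ f : ℝ → V →L[ℝ] ℝ, ContDiffOn ℝ 1 f (Set.Icc 0 T) →
      ∀ (g : ℝ → Q →L[ℝ] ℝ) (u ubar : ℝ → V) (p pbar : ℝ → Q),
        ContDiffOn ℝ 1 u (Set.Icc 0 T) → ContDiffOn ℝ 1 ubar (Set.Icc 0 T) →
        ContDiffOn ℝ 1 (fun s => ι (p s)) (Set.Icc 0 T) →
        ContDiffOn ℝ (k + 1) (fun s => ι (pbar s)) (Set.Icc (-τ) T) →
        (∀ t ∈ Set.Icc (0 : ℝ) T, ∀ v : V, a (u t) v - d v (ι (p t)) = f t v) →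
        (∀ t ∈ Set.Icc (0 : ℝ) T, ∀ q : Q,
          d (derivWithin u (Set.Icc 0 T) t) (ι q)
            + c (derivWithin (fun s => ι (p s)) (Set.Icc 0 T) t) (ι q)
            + b (p t) q = g t q) →
        (∀ t ∈ Set.Icc (0 : ℝ) T, ∀ v : V,
          a (ubar t) v
            - d v (∑ j ∈ Finset.range k, (τ ^ j / (Nat.factorial j : ℝ)) •
                iteratedDerivWithin j (fun s => ι (pbar s)) (Set.Icc (-τ) T) (t - τ))
          = f t v) →
        (∀ t ∈ Set.Icc (0 : ℝ) T, ∀ q : Q,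
          d (derivWithin ubar (Set.Icc 0 T) t) (ι q)
            + c (derivWithin (fun s => ι (pbar s)) (Set.Icc (-τ) T) t) (ι q)
            + b (pbar t) q = g t q) →
        pbar (-τ) = p 0 → pbar 0 = p 0 →
        (∀ j : ℕ, 1 ≤ j → j ≤ k - 1 →
          iteratedDerivWithin j (fun s => ι (pbar s)) (Set.Icc (-τ) T) (-τ) = 0) →
      ∀ Mk Mk1 : ℝ,
        (∀ s ∈ Set.Icc (-τ) T,
          ‖iteratedDerivWithin k (fun s => ι (pbar s)) (Set.Icc (-τ) T) s‖ ≤ Mk) →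
        (∀ s ∈ Set.Icc (-τ) T,
          ‖iteratedDerivWithin (k + 1) (fun s => ι (pbar s)) (Set.Icc (-τ) T) s‖ ≤ Mk1) →
      ∀ t ∈ Set.Icc (0 : ℝ) T,
        ‖pbar t - p t‖ ^ 2 + ‖ubar t - u t‖ ^ 2
          ≤ C * t * τ ^ (2 * k) * (Mk ^ 2 + Mk1 ^ 2) := by
  refine ⟨C_d ^ 2 / c_a * (1 / c_a + 1 / c_b) + 1, by positivity, ?_⟩
  intro V Q H _ _ _ _ _ _ _ _ _ ι _ a ha ha' haC b hb hb' _ c hc hc' hcC d hd τ T hτ hT f _ g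
    u ubar p pbar hu hubar hp hpbar ell par ellbar parbar hp1 hp0 hhist Mk Mk1 hMk hMk1 t ht
  set P : ℝ → H := fun s => ι (pbar s) with hP
  have hI : UniqueDiffOn ℝ (Icc 0 T) := uniqueDiffOn_Icc hT
  have hJ : UniqueDiffOn ℝ (Icc (-τ) T) := uniqueDiffOn_Icc (by linarith)
  have hIJ : Icc 0 T ⊆ Icc (-τ) T := Icc_subset_Icc_left (by linarith)
  have hshift : MapsTo (fun x => x - τ) (Icc 0 T) (Icc (-τ) T) := fun x hx =>
    ⟨by linarith [hx.1], by linarith [hx.2]⟩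
  have hPk : ContDiffOn ℝ k P (Icc (-τ) T) := hpbar.of_le (by exact_mod_cast k.le_succ)
  have hP1 : ContDiffOn ℝ 1 P (Icc (-τ) T) := hpbar.of_le (by exact_mod_cast Nat.le_add_left 1 k)
  have hP'k : ContDiffOn ℝ k (derivWithin P (Icc (-τ) T)) (Icc (-τ) T) :=
    hpbar.derivWithin hJ le_rfl
  have hPd : ∀ s ∈ Icc 0 T,
      HasDerivWithinAt P (derivWithin P (Icc (-τ) T) s) (Icc 0 T) s := fun s hs =>
    ((hP1.differentiableOn one_ne_zero) s (hIJ hs)).hasDerivWithinAt.mono hIJ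
  have hud : ∀ s ∈ Icc 0 T, HasDerivWithinAt u (derivWithin u (Icc 0 T) s) (Icc 0 T) s :=
    fun s hs => ((hu.differentiableOn one_ne_zero) s hs).hasDerivWithinAt
  have hubard : ∀ s ∈ Icc 0 T,
      HasDerivWithinAt ubar (derivWithin ubar (Icc 0 T) s) (Icc 0 T) s :=
    fun s hs => ((hubar.differentiableOn one_ne_zero) s hs).hasDerivWithinAt
  have hpd : ∀ s ∈ Icc 0 T, HasDerivWithinAt (fun s => ι (p s))
      (derivWithin (fun s => ι (p s)) (Icc 0 T) s) (Icc 0 T) s :=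
    fun s hs => ((hp.differentiableOn one_ne_zero) s hs).hasDerivWithinAt
  have hsum0 : delayTaylorSum k P (Icc (-τ) T) τ 0 = ι (p 0) := by
    rw [delayTaylorSum, Finset.sum_eq_single 0]
    · simp [hP, hp1]
    · intro j hj hj0
      have : j < k := Finset.mem_range.1 hj
      rw [zero_sub, hhist j (by omega) (by omega), smul_zero]
    · intro h
      exact absurd (Finset.mem_range.2 hk) h
  have he0 : ubar 0 - u 0 = 0 := by
    have h0 : (0 : ℝ) ∈ Icc 0 T := ⟨le_rfl, hT.le⟩
    have h1 := ell 0 h0 (ubar 0 - u 0)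
    have h2 : a (ubar 0) (ubar 0 - u 0)
        - d (ubar 0 - u 0) (delayTaylorSum k P (Icc (-τ) T) τ 0) = f 0 (ubar 0 - u 0) :=
      ellbar 0 h0 (ubar 0 - u 0)
    rw [hsum0] at h2
    have h3 := ha' (ubar 0 - u 0)
    rw [a.map_sub, LinearMap.sub_apply] at h3
    have h4 : c_a * ‖ubar 0 - u 0‖ ^ 2 ≤ 0 := by linarith
    have h5 : ‖ubar 0 - u 0‖ ^ 2 ≤ 0 := by
      by_contra! h
      exact absurd h4 (not_le.2 (by positivity))
    exact norm_eq_zero.1 (pow_eq_zero_iff two_ne_zero |>.1 (le_antisymm h5 (sq_nonneg _)))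
  have key := elliptic_parabolic_energy_estimate (ι := ι) (C_d := C_d) hca hcb
    (a := a.mkContinuous₂ C_a haC) ha ha' hb hb' (c := c.mkContinuous₂ C_c hcC) hc
    (fun x => le_trans (by positivity) (hc' x)) (d := d.mkContinuous₂ C_d hd) hd hT
    (e := fun s => ubar s - u s)
    (e' := fun s => derivWithin ubar (Icc 0 T) s - derivWithin u (Icc 0 T) s)
    (q := fun s => pbar s - p s)
    (η' := fun s => derivWithin P (Icc (-τ) T) s - derivWithin (fun s => ι (p s)) (Icc 0 T) s)
    (R := fun s => P s - delayTaylorSum k P (Icc (-τ) T) τ s)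
    (m := τ ^ k * Mk) (m' := τ ^ k * Mk1)
    (fun s hs => (hubard s hs).sub (hud s hs))
    (fun s hs => by simpa only [map_sub] using (hPd s hs).fun_sub (hpd s hs))
    (fun s hs => (hPd s hs).sub (hasDerivWithinAt_delayTaylorSum hJ hPk hshift hs))
    ((hubar.continuousOn_derivWithin hI le_rfl).sub (hu.continuousOn_derivWithin hI le_rfl))
    (((hP1.continuousOn_derivWithin hJ le_rfl).mono hIJ).sub
      (hp.continuousOn_derivWithin hI le_rfl))
    (fun s hs v => by
      have h1 := ell s hs v
      have h2 : a (ubar s) v - d v (delayTaylorSum k P (Icc (-τ) T) τ s) = f s v :=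
        ellbar s hs v
      simp only [LinearMap.mkContinuous₂_apply, map_sub, sub_apply, hP] at h1 h2 ⊢
      linarith)
    (fun s hs r => by
      have h1 := par s hs r
      have h2 := parbar s hs r
      simp only [LinearMap.mkContinuous₂_apply, map_sub, sub_apply, LinearMap.sub_apply] at h1 h2 ⊢
      linarith)
    he0 (by rw [hp0, sub_self])
    (fun s hs => norm_sub_delayTaylorSum_le hk hτ hPk (by linarith [hs.1]) hs.2 hMk)
    (fun s hs => norm_sub_delayTaylorSum_le hk hτ hP'k (by linarith [hs.1]) hs.2
      (by simpa only [iteratedDerivWithin_succ'] using hMk1)) ht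
  have hB : C_d ^ 2 / c_a * t * ((τ ^ k * Mk) ^ 2 + (τ ^ k * Mk1) ^ 2)
      = C_d ^ 2 / c_a * (t * τ ^ (2 * k) * (Mk ^ 2 + Mk1 ^ 2)) := by ring
  have hX : 0 ≤ t * τ ^ (2 * k) * (Mk ^ 2 + Mk1 ^ 2) := by
    have := ht.1
    positivity
  rw [hB] at key
  set X := t * τ ^ (2 * k) * (Mk ^ 2 + Mk1 ^ 2) with hXdef
  have hu' : ‖ubar t - u t‖ ^ 2 ≤ C_d ^ 2 / c_a * X * (1 / c_a) := by
    rw [mul_one_div, le_div_iff₀ hca]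
    linarith [mul_nonneg hcb.le (sq_nonneg ‖pbar t - p t‖)]
  have hp' : ‖pbar t - p t‖ ^ 2 ≤ C_d ^ 2 / c_a * X * (1 / c_b) := by
    rw [mul_one_div, le_div_iff₀ hcb]
    linarith [mul_nonneg hca.le (sq_nonneg ‖ubar t - u t‖)]
  calc ‖pbar t - p t‖ ^ 2 + ‖ubar t - u t‖ ^ 2
      ≤ C_d ^ 2 / c_a * X * (1 / c_b) + C_d ^ 2 / c_a * X * (1 / c_a) + X := by linarith
    _ = _ := by rw [hXdef]; ring
end
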